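/- Fix n ≥ 1, a covariate matrix X ∈ ℝ^{n×d}, group labels Z ∈ {1,…,H}ⁿ, a symmetric positive semidefinite kernel K, δ₀, σ₀ > 0, and γ ∈ ℝ, and suppose Y ∈ ℝⁿ is multivariate Gaussian with mean 0 and covariance (δ₀²/n^{1−γ})·K_n + σ₀²·I_n. Fix a permutation size b ∈ {1,…,n}, any test statistic T, and α₀ ∈ (0,1). Let ξ_n = (δ₀²/n^{1−γ})/σ₀², let c_{n−b+1} be the (n−b+1)-th largest eigenvalue of K_n, let ω̃(b,ξ_n) = ξ_n·c_{n−b+1}, and let ṽ(b,ξ_n,α₀) = (1/2)·exp{(1/2)·ω̃(b,ξ_n)·Q_b(1−α₀)} − 1/2. Then the corrected partial permutation p-value p̃_c(X,Y,Z) = p(X,Y,Z) + ṽ(b,ξ_n,α₀) + α₀ (with p either the discrete or the continuous partial permutation p-value with kernel K and permutation size b) is valid: Pr(p̃_c(X,Y,Z) ≤ α) ≤ α for every α ∈ (0,1). -/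

import Mathlib

open MeasureTheory ProbabilityTheory Filter

noncomputable section

namespace PPT

/-- The law of `k` i.i.d. standard Gaussian random variables. -/
def stdGaussianPi (k : ℕ) : Measure (Fin k → ℝ) :=
  Measure.pi fun _ => gaussianReal 0 1

/-- The law of `n` i.i.d. centered Gaussian noises with standard deviation `σ`. -/
def noiseLaw (n : ℕ) (σ : ℝ) : Measure (Fin n → ℝ) :=
  Measure.pi fun _ => gaussianReal 0 ((σ ^ 2).toNNReal)

/-- Matrix (given as a function) times vector. -/
def mulVecF {n m : ℕ} (A : Fin n → Fin m → ℝ) (v : Fin m → ℝ) : Fin n → ℝ :=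
  fun i => ∑ j, A i j * v j

/-- Transposed matrix times vector, `Aᵀ v`. -/
def tmulVecF {n : ℕ} (A : Fin n → Fin n → ℝ) (v : Fin n → ℝ) : Fin n → ℝ :=
  fun i => ∑ j, A j i * v j

/-- Matrix product of matrices given as functions. -/
def mulF {n : ℕ} (A B : Fin n → Fin n → ℝ) : Fin n → Fin n → ℝ :=
  fun i j => ∑ k, A i k * B k j

/-- The identity matrix as a function. -/
def idF (n : ℕ) : Fin n → Fin n → ℝ :=
  fun i j => if i = j then 1 else 0

/-- Quadratic form `vᵀ A v`. -/
def quadForm {n : ℕ} (A : Fin n → Fin n → ℝ) (v : Fin n → ℝ) : ℝ :=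
  ∑ i, ∑ j, v i * A i j * v j

/-- `A` is an orthogonal matrix: `A Aᵀ = I`. -/
def IsOrthogonalF {n : ℕ} (A : Fin n → Fin n → ℝ) : Prop :=
  ∀ i j, (∑ k, A i k * A j k) = if i = j then (1 : ℝ) else 0

/-- `(Γ, c)` is an eigendecomposition `Kmat = Γ diag(c) Γᵀ` of `Kmat`, with `Γ` orthogonal and
the eigenvalues `c` nonnegative and in nonincreasing order. -/
def IsEigenDecomp {n : ℕ} (Kmat Γ : Fin n → Fin n → ℝ) (c : Fin n → ℝ) : Prop :=
  IsOrthogonalF Γ ∧ (∀ i j, Kmat i j = ∑ k, Γ i k * c k * Γ j k) ∧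
    (∀ i j : Fin n, i ≤ j → c j ≤ c i) ∧ (∀ i, 0 ≤ c i)

/-- A symmetric positive semidefinite kernel on `ℝᵈ`. -/
def IsPSDKernel {d : ℕ} (K : (Fin d → ℝ) → (Fin d → ℝ) → ℝ) : Prop :=
  (∀ x y, K x y = K y x) ∧
    ∀ (m : ℕ) (v : Fin m → (Fin d → ℝ)) (a : Fin m → ℝ),
      0 ≤ ∑ i, ∑ j, a i * a j * K (v i) (v j)

/-- The set `M(n,b)` of permutations of `{0, …, n-1}` keeping the first `n - b` elements fixed. -/
def permSet (n b : ℕ) : Finset (Equiv.Perm (Fin n)) :=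
  Finset.univ.filter fun ψ => ∀ i : Fin n, (i : ℕ) < n - b → ψ i = i

/-- The discrete partial permutation p-value, with covariates `X`, group labels `Z`,
test statistic `T`, eigenvector matrix `Γ`, permutation size `b` and responses `Y`. -/
def pDisc {n d H : ℕ} (X : Fin n → Fin d → ℝ) (Z : Fin n → Fin H)
    (T : (Fin n → Fin d → ℝ) → (Fin n → ℝ) → (Fin n → Fin H) → ℝ)
    (Γ : Fin n → Fin n → ℝ) (b : ℕ) (Y : Fin n → ℝ) : ℝ :=
  ((permSet n b).card : ℝ)⁻¹ *
    ∑ ψ ∈ permSet n b,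
      if T X Y Z ≤ T X (mulVecF Γ ((tmulVecF Γ Y) ∘ ψ)) Z then 1 else 0

/-- Squared norm of the last `b` coordinates of a vector in `ℝⁿ`. -/
def tailNormSq {n : ℕ} (b : ℕ) (w : Fin n → ℝ) : ℝ :=
  ∑ i ∈ Finset.univ.filter (fun i : Fin n => n - b ≤ (i : ℕ)), w i ^ 2

/-- The continuous partial permutation of `w` driven by `g`: it agrees with `w` on the first
`n - b` coordinates, and its last `b` coordinates are those of `g` rescaled to lie on the sphere
of radius `(Σ_{i ≥ n-b} w i ^ 2)^{1/2}`.  When `g` is standard Gaussian, the last `b` coordinates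
are uniformly distributed on that sphere. -/
def wStar {n : ℕ} (b : ℕ) (w g : Fin n → ℝ) : Fin n → ℝ := fun i =>
  if (i : ℕ) < n - b then w i
  else Real.sqrt (tailNormSq b w) * g i / Real.sqrt (tailNormSq b g)

/-- The continuous partial permutation p-value. -/
def pCont {n d H : ℕ} (X : Fin n → Fin d → ℝ) (Z : Fin n → Fin H)
    (T : (Fin n → Fin d → ℝ) → (Fin n → ℝ) → (Fin n → Fin H) → ℝ)
    (Γ : Fin n → Fin n → ℝ) (b : ℕ) (Y : Fin n → ℝ) : ℝ :=
  (stdGaussianPi n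
    {g | T X Y Z ≤ T X (mulVecF Γ (wStar b (tmulVecF Γ Y) g)) Z}).toReal

/-- The chi-squared distribution with `k` degrees of freedom, realized as the law of the sum of
squares of `k` independent standard Gaussians. -/
def chiSq (k : ℕ) : Measure ℝ :=
  Measure.map (fun g : Fin k → ℝ => ∑ i, g i ^ 2) (stdGaussianPi k)

/-- The quantile function of the chi-squared distribution with `k` degrees of freedom. -/
def chiSqQuantile (k : ℕ) (p : ℝ) : ℝ :=
  sInf {x : ℝ | ENNReal.ofReal p ≤ chiSq k (Set.Iic x)}

end PPT


theorem aux_upper (m : Measure ℝ) (t : ENNReal) : m {x | m (Set.Ici x) ≤ t} ≤ t := by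
  set S := {x | m (Set.Ici x) ≤ t} with hS
  have hup : ∀ x ∈ S, ∀ y, x ≤ y → y ∈ S := fun x hx y hxy =>
    (measure_mono (Set.Ici_subset_Ici.2 hxy)).trans hx
  by_cases hmin : ∃ a ∈ S, ∀ x ∈ S, a ≤ x
  · obtain ⟨a, ha, hle⟩ := hmin
    exact (measure_mono (fun x hx => hle x hx)).trans ha
  · push Not at hmin
    have hcov : S ⊆ ⋃ q : {q : ℚ // (q : ℝ) ∈ S}, Set.Ici ((q : ℚ) : ℝ) := by
      intro x hx
      obtain ⟨y, hy, hyx⟩ := hmin x hx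
      obtain ⟨q, h1, h2⟩ := exists_rat_btwn hyx
      exact Set.mem_iUnion.2 ⟨⟨q, hup y hy _ h1.le⟩, h2.le⟩
    refine (measure_mono hcov).trans ?_
    rw [Directed.measure_iUnion]
    · exact iSup_le fun q => q.2
    · intro a b
      rcases le_total (a : ℚ) (b : ℚ) with h | h
      · exact ⟨a, le_refl _, Set.Ici_subset_Ici.2 (by exact_mod_cast h)⟩
      · exact ⟨b, Set.Ici_subset_Ici.2 (by exact_mod_cast h), le_refl _⟩

theorem aux_pval {S : Type*} [MeasurableSpace S] (ν : Measure S) (f : S → ℝ) (hf : Measurable f)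
    (t : ENNReal) : ν {s | ν {s' | f s ≤ f s'} ≤ t} ≤ t := by
  have h := aux_upper (ν.map f) t
  have hm : MeasurableSet {x | (ν.map f) (Set.Ici x) ≤ t} := by
    refine (IsUpperSet.ordConnected ?_).measurableSet
    intro x y hxy hx
    exact (measure_mono (Set.Ici_subset_Ici.2 hxy)).trans hx
  rw [Measure.map_apply hf hm] at h
  convert h using 3
  ext s
  simp only [Set.mem_ofPred_eq, Set.mem_preimage]
  rw [Measure.map_apply hf measurableSet_Ici]
  rfl

theorem aux_tv {S : Type*} [MeasurableSpace S] (ν : Measure S) [IsProbabilityMeasure ν]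
    (h : S → ℝ) (hh : Measurable h) (A : Set S) (hA : MeasurableSet A) (m R : ℝ) (hm : 0 ≤ m)
    (hR : 1 ≤ R) (hb : ∀ᵐ s ∂ν, m ≤ h s ∧ h s ≤ R * m) (t : ℝ) (ht : ν A ≤ ENNReal.ofReal t)
    (ht0 : 0 ≤ t) :
    ∫⁻ s in A, ENNReal.ofReal (h s) ∂ν ≤
      ENNReal.ofReal (t + (R - 1) / 2) * ∫⁻ s, ENNReal.ofReal (h s) ∂ν := by
  have hinteg : Integrable h ν := by
    refine Integrable.of_bound hh.aestronglyMeasurable (R * m) ?_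
    filter_upwards [hb] with s hs
    rw [Real.norm_of_nonneg (hm.trans hs.1)]; exact hs.2
  have hnn : 0 ≤ᵐ[ν] h := by
    filter_upwards [hb] with s hs using hm.trans hs.1
  rw [← ofReal_integral_eq_lintegral_ofReal hinteg hnn,
    ← ofReal_integral_eq_lintegral_ofReal hinteg.integrableOn (ae_restrict_of_ae hnn),
    ← ENNReal.ofReal_mul (by linarith)]
  apply ENNReal.ofReal_le_ofReal
  rw [← integral_add_compl hA hinteg]
  have h1 : ∫ s in A, h s ∂ν ≤ ν.real A * (R * m) := by
    have := integral_mono_ae (μ := ν.restrict A) hinteg.integrableOn (integrable_const (R * m))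
      (ae_restrict_of_ae (by filter_upwards [hb] with s hs using hs.2))
    simpa using this
  have h2 : ν.real Aᶜ * m ≤ ∫ s in Aᶜ, h s ∂ν := by
    have := integral_mono_ae (μ := ν.restrict Aᶜ) (integrable_const m) hinteg.integrableOn
      (ae_restrict_of_ae (by filter_upwards [hb] with s hs using hs.1))
    simpa using this
  have h3 : ν.real A * m ≤ ∫ s in A, h s ∂ν := by
    have := integral_mono_ae (μ := ν.restrict A) (integrable_const m) hinteg.integrableOn
      (ae_restrict_of_ae (by filter_upwards [hb] with s hs using hs.1))
    simpa using this
  have hat : ν.real A ≤ t := ENNReal.toReal_le_of_le_ofReal ht0 ht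
  have ha0 : 0 ≤ ν.real A := measureReal_nonneg
  have ha1 : ν.real A ≤ 1 := measureReal_le_one
  rw [probReal_compl_eq_one_sub hA] at h2
  generalize ν.real A = a at *
  generalize ∫ s in A, h s ∂ν = I at *
  generalize ∫ s in Aᶜ, h s ∂ν = J at *
  have hI : 0 ≤ I := le_trans (by positivity) h3
  have hJ : 0 ≤ J := le_trans (mul_nonneg (by linarith) hm) h2
  have e1 : I * (1 - a) ≤ a * (R * m) * (1 - a) := mul_le_mul_of_nonneg_right h1 (by linarith)
  have e2 : (1 - a) * m * a ≤ J * a := mul_le_mul_of_nonneg_right h2 ha0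
  have e3 : (R - 1) / 2 * m ≤ (R - 1) / 2 * (I + J) :=
    mul_le_mul_of_nonneg_left (by nlinarith) (by linarith)
  have e4 : a * (I + J) ≤ t * (I + J) := mul_le_mul_of_nonneg_right hat (by linarith)
  have e5 : a * (1 - a) * ((R - 1) * m) ≤ 1 / 2 * ((R - 1) * m) :=
    mul_le_mul_of_nonneg_right (by nlinarith [sq_nonneg (a - 1/2)]) (mul_nonneg (by linarith) hm)
  nlinarith

theorem aux_main {Ω S : Type*} [MeasurableSpace Ω] [MeasurableSpace S]
    (μ0 : Measure Ω) (ν : Measure S) [IsProbabilityMeasure ν]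
    (Φ : Ω → S → Ω) (hΦ : Measurable (Function.uncurry Φ))
    (ρ : Ω → ℝ) (hρ : Measurable ρ)
    (hprob : IsProbabilityMeasure (μ0.withDensity fun w => ENNReal.ofReal (ρ w)))
    (hinv : ∀ F : Ω → ENNReal, Measurable F → ∫⁻ w, ∫⁻ s, F (Φ w s) ∂ν ∂μ0 = ∫⁻ w, F w ∂μ0)
    (T : Ω → ℝ) (hT : Measurable T) (p : Ω → ℝ) (hpm : Measurable p)
    (hp : ∀ w, ∀ᵐ s ∂ν, p (Φ w s) = (ν {s' | T (Φ w s) ≤ T (Φ w s')}).toReal)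
    (E : Set Ω) (hE : MeasurableSet E) (hE1 : ∀ w, ∀ᵐ s ∂ν, (Φ w s ∈ E ↔ w ∈ E))
    (R : ℝ) (hR : 1 ≤ R)
    (hb : ∀ w ∈ E, ∃ m, 0 ≤ m ∧ ∀ᵐ s ∂ν, m ≤ ρ (Φ w s) ∧ ρ (Φ w s) ≤ R * m)
    (α0 : ℝ) (hα0 : 0 ≤ α0)
    (hEc : (μ0.withDensity fun w => ENNReal.ofReal (ρ w)) Eᶜ ≤ ENNReal.ofReal α0)
    (t : ℝ) (ht0 : 0 ≤ t) :
    (μ0.withDensity fun w => ENNReal.ofReal (ρ w)) {w | p w ≤ t} ≤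
      ENNReal.ofReal (t + (R - 1) / 2 + α0) := by
  set μ := μ0.withDensity fun w => ENNReal.ofReal (ρ w) with hμ
  have hA : MeasurableSet {w | p w ≤ t} := measurableSet_le hpm measurable_const
  have hΦw : ∀ w, Measurable (Φ w) := fun w => hΦ.comp measurable_prodMk_left
  have key : ∫⁻ w, ({w | p w ≤ t} ∩ E).indicator (fun w => ENNReal.ofReal (ρ w)) w ∂μ0 ≤
      ENNReal.ofReal (t + (R - 1) / 2) *
        ∫⁻ w, E.indicator (fun w => ENNReal.ofReal (ρ w)) w ∂μ0 := by
    rw [← hinv _ (hρ.ennreal_ofReal.indicator (hA.inter hE)),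
      ← hinv _ (hρ.ennreal_ofReal.indicator hE), ← lintegral_const_mul']
    swap
    · exact ENNReal.ofReal_ne_top
    apply lintegral_mono
    intro w
    dsimp only
    by_cases hw : w ∈ E
    · obtain ⟨m, hm, hbm⟩ := hb w hw
      have h1 : ∫⁻ s, ({w | p w ≤ t} ∩ E).indicator (fun w => ENNReal.ofReal (ρ w)) (Φ w s) ∂ν
          = ∫⁻ s in {s | p (Φ w s) ≤ t}, ENNReal.ofReal (ρ (Φ w s)) ∂ν := by
        have hA' : MeasurableSet {s | p (Φ w s) ≤ t} := (hΦw w) hA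
        rw [← lintegral_indicator hA']
        apply lintegral_congr_ae
        filter_upwards [hE1 w] with s hs
        simp [Set.indicator, hs, hw]
      have h2 : ∫⁻ s, E.indicator (fun w => ENNReal.ofReal (ρ w)) (Φ w s) ∂ν
          = ∫⁻ s, ENNReal.ofReal (ρ (Φ w s)) ∂ν := by
        apply lintegral_congr_ae
        filter_upwards [hE1 w] with s hs
        simp [Set.indicator, hs, hw]
      rw [h1, h2]
      refine aux_tv ν _ (hρ.comp (hΦw w)) _ ((hΦw w) hA) m R hm hR hbm t ?_ ht0
      refine le_trans (le_of_eq ?_) (aux_pval ν (fun s => T (Φ w s)) (hT.comp (hΦw w))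
        (ENNReal.ofReal t))
      apply measure_congr
      filter_upwards [hp w] with s hs
      apply propext
      change p (Φ w s) ≤ t ↔ ν {s' | T (Φ w s) ≤ T (Φ w s')} ≤ ENNReal.ofReal t
      rw [hs, ENNReal.le_ofReal_iff_toReal_le (measure_ne_top _ _) ht0]
    · have h1 : ∫⁻ s, ({w | p w ≤ t} ∩ E).indicator (fun w => ENNReal.ofReal (ρ w)) (Φ w s) ∂ν
          = ∫⁻ s, 0 ∂ν := by
        apply lintegral_congr_ae
        filter_upwards [hE1 w] with s hs
        simp [Set.indicator, hs, hw]
      rw [h1]; simp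
  rw [lintegral_indicator (hA.inter hE), lintegral_indicator hE,
    ← withDensity_apply _ (hA.inter hE), ← withDensity_apply _ hE, ← hμ] at key
  calc μ {w | p w ≤ t} ≤ μ (({w | p w ≤ t} ∩ E) ∪ Eᶜ) := by
        apply measure_mono
        intro w hw
        by_cases h : w ∈ E
        · exact Or.inl ⟨hw, h⟩
        · exact Or.inr h
    _ ≤ μ ({w | p w ≤ t} ∩ E) + μ Eᶜ := measure_union_le _ _
    _ ≤ ENNReal.ofReal (t + (R - 1) / 2) + ENNReal.ofReal α0 := by
        refine add_le_add (key.trans ?_) hEc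
        exact mul_le_of_le_one_right' prob_le_one
    _ = _ := by rw [← ENNReal.ofReal_add (by linarith) hα0]

theorem aux_pi_density {ι : Type*} [Fintype ι] (v : ι → NNReal) (hv : ∀ i, v i ≠ 0) :
    Measure.pi (fun i => gaussianReal 0 (v i)) =
      (volume : Measure (ι → ℝ)).withDensity
        (fun w => ENNReal.ofReal (∏ i, gaussianPDFReal 0 (v i) (w i))) := by
  refine Measure.pi_eq fun s hs => ?_
  rw [withDensity_apply _ (MeasurableSet.univ_pi hs), ← lintegral_indicator (MeasurableSet.univ_pi hs)]
  have h1 : ∀ w : ι → ℝ, (Set.univ.pi s).indicator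
      (fun w => ENNReal.ofReal (∏ i, gaussianPDFReal 0 (v i) (w i))) w =
      ENNReal.ofReal (∏ i, (s i).indicator (gaussianPDFReal 0 (v i)) (w i)) := by
    intro w
    by_cases hw : w ∈ Set.univ.pi s
    · rw [Set.indicator_of_mem hw]
      congr 1
      refine Finset.prod_congr rfl fun i _ => ?_
      rw [Set.indicator_of_mem (hw i trivial)]
    · rw [Set.indicator_of_notMem hw]
      simp only [Set.mem_pi, Set.mem_univ, true_implies, not_forall] at hw
      obtain ⟨i, hi⟩ := hw
      rw [Finset.prod_eq_zero (Finset.mem_univ i) (Set.indicator_of_notMem hi _)]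
      simp
  simp_rw [h1]
  have hinteg : ∀ i, Integrable ((s i).indicator (gaussianPDFReal 0 (v i))) :=
    fun i => (integrable_gaussianPDFReal 0 (v i)).indicator (hs i)
  have hnn : ∀ i x, 0 ≤ (s i).indicator (gaussianPDFReal 0 (v i)) x :=
    fun i x => Set.indicator_nonneg (fun x _ => gaussianPDFReal_nonneg _ _ _) x
  rw [volume_pi, ← ofReal_integral_eq_lintegral_ofReal (Integrable.fintype_prod hinteg)
    (ae_of_all _ fun w => Finset.prod_nonneg fun i _ => hnn i _),
    integral_fintype_prod_eq_prod (f := fun i => (s i).indicator (gaussianPDFReal 0 (v i))),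
    ENNReal.ofReal_prod_of_nonneg (fun i _ => integral_nonneg (hnn i))]
  refine Finset.prod_congr rfl fun i _ => ?_
  rw [gaussianReal_apply_eq_integral _ (hv i), integral_indicator (hs i)]

theorem aux_polar {E : Type*} [NormedAddCommGroup E] [NormedSpace ℝ E] [FiniteDimensional ℝ E]
    [MeasurableSpace E] [BorelSpace E] [Nontrivial E] (μ : Measure E) [μ.IsAddHaarMeasure]
    (F : E → ENNReal) (hF : Measurable F) :
    ∫⁻ x, F x ∂μ = ∫⁻ y, ∫⁻ r, F ((r : Set.Ioi (0 : ℝ)).1 • y.1)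
      ∂(Measure.volumeIoiPow (Module.finrank ℝ E - 1)) ∂μ.toSphere := by
  have hm : Measurable (fun q : Metric.sphere (0 : E) 1 × Set.Ioi (0 : ℝ) => F (q.2.1 • q.1.1)) := by
    fun_prop
  rw [← lintegral_prod _ hm.aemeasurable,
    ← μ.measurePreserving_homeomorphUnitSphereProd.lintegral_comp hm]
  have : ∀ x : ({0}ᶜ : Set E), F ((homeomorphUnitSphereProd E x).2.1 •
      (homeomorphUnitSphereProd E x).1.1) = F x := by
    intro x
    congr 1
    have := homeomorphUnitSphereProd_symm_apply_coe E (homeomorphUnitSphereProd E x)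
    rw [← this]; simp
  simp_rw [this]
  rw [lintegral_subtype_comap (measurableSet_singleton _).compl, restrict_compl_singleton]

theorem aux_sphere {E : Type*} [NormedAddCommGroup E] [NormedSpace ℝ E] [FiniteDimensional ℝ E]
    [MeasurableSpace E] [BorelSpace E] [Nontrivial E] (μ : Measure E) [μ.IsAddHaarMeasure]
    (φ : ℝ → ENNReal) (hφ : Measurable φ)
    (hν : ∫⁻ x, φ ‖x‖ ∂μ = 1)
    (F : E → ENNReal) (hF : Measurable F) :
    ∫⁻ w, ∫⁻ g, φ ‖g‖ * F ((‖w‖ / ‖g‖) • g) ∂μ ∂μ = ∫⁻ w, F w ∂μ := by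
  set lam := Measure.volumeIoiPow (Module.finrank ℝ E - 1)
  set A := ∫⁻ r : Set.Ioi (0 : ℝ), φ r.1 ∂lam with hA
  have hφn : Measurable fun x : E => φ ‖x‖ := hφ.comp measurable_norm
  have hnorm : ∀ (y : Metric.sphere (0 : E) 1) (r : Set.Ioi (0 : ℝ)), ‖r.1 • y.1‖ = r.1 := by
    intro y r
    have hr : (0 : ℝ) < r.1 := r.2
    have hy : ‖y.1‖ = 1 := by simp
    rw [norm_smul, hy, Real.norm_of_nonneg hr.le, mul_one]
  have hmass : A * μ.toSphere Set.univ = 1 := by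
    rw [← hν, aux_polar μ _ hφn]
    simp_rw [hnorm]
    rw [lintegral_const]
  have hin : ∀ w : E, ∫⁻ g, φ ‖g‖ * F ((‖w‖ / ‖g‖) • g) ∂μ =
      A * ∫⁻ y, F (‖w‖ • y.1) ∂μ.toSphere := by
    intro w
    have hmeas : Measurable fun g : E => φ ‖g‖ * F ((‖w‖ / ‖g‖) • g) :=
      hφn.mul (hF.comp (by fun_prop))
    rw [aux_polar μ _ hmeas]
    have hm2 : Measurable fun y : Metric.sphere (0 : E) 1 => F (‖w‖ • y.1) := by fun_prop
    rw [← lintegral_const_mul _ hm2]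
    apply lintegral_congr
    intro y
    rw [hA, ← lintegral_mul_const _ (by fun_prop)]
    apply lintegral_congr
    intro r
    have hr : (0 : ℝ) < r.1 := r.2
    rw [hnorm, smul_smul, div_mul_cancel₀ _ hr.ne']
  simp_rw [hin]
  have hmo : Measurable fun q : E × Metric.sphere (0 : E) 1 => F (‖q.1‖ • q.2.1) := by fun_prop
  have hmr : Measurable fun q : Set.Ioi (0 : ℝ) × Metric.sphere (0 : E) 1 => F (q.1.1 • q.2.1) := by
    fun_prop
  rw [lintegral_const_mul _ hmo.lintegral_prod_right', aux_polar μ _ hmo.lintegral_prod_right']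
  simp_rw [hnorm]
  rw [lintegral_const, lintegral_lintegral_swap hmr.aemeasurable, ← aux_polar μ F hF,
    mul_comm (∫⁻ w, F w ∂μ), ← mul_assoc, hmass, one_mul]

theorem aux_tail {ι : Type*} [Fintype ι] [Nonempty ι] (F : (ι → ℝ) → ENNReal) (hF : Measurable F) :
    ∫⁻ w : ι → ℝ, ∫⁻ g, F (fun i => Real.sqrt (∑ j, w j ^ 2) * g i / Real.sqrt (∑ j, g j ^ 2))
      ∂(Measure.pi fun _ : ι => gaussianReal 0 1) = ∫⁻ w, F w := by
  have hd := aux_pi_density (fun _ : ι => (1 : NNReal)) (fun _ => one_ne_zero)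
  let φ : ℝ → ENNReal := fun r =>
    ENNReal.ofReal ((Real.sqrt (2 * Real.pi))⁻¹ ^ (Fintype.card ι) * Real.exp (- r ^ 2 / 2))
  have hφ : Measurable φ := by fun_prop
  have hden : ∀ x : EuclideanSpace ℝ ι, ENNReal.ofReal (∏ i, gaussianPDFReal 0 1 (x i)) = φ ‖x‖ := by
    intro x
    simp only [φ, gaussianPDFReal_def]
    rw [Finset.prod_mul_distrib, ← Real.exp_sum, EuclideanSpace.norm_sq_eq]
    simp [Finset.sum_div, Finset.sum_neg_distrib, neg_div]
  have hmp := EuclideanSpace.volume_preserving_symm_measurableEquiv_toLp ι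
  have htr : ∀ G : (ι → ℝ) → ENNReal, ∫⁻ w, G w = ∫⁻ x : EuclideanSpace ℝ ι, G (WithLp.ofLp x) :=
    fun G => (hmp.lintegral_comp_emb (MeasurableEquiv.measurableEmbedding _) G).symm
  have hdm : Measurable fun w : ι → ℝ => ENNReal.ofReal (∏ i, gaussianPDFReal 0 1 (w i)) := by
    have := measurable_gaussianPDFReal 0 1
    fun_prop
  have hone : ∫⁻ x : EuclideanSpace ℝ ι, φ ‖x‖ = 1 := by
    simp_rw [← hden]
    rw [← htr (fun w => ENNReal.ofReal (∏ i, gaussianPDFReal 0 1 (w i)))]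
    have h1 : Measure.pi (fun _ : ι => gaussianReal 0 1) Set.univ = 1 := measure_univ
    rw [hd, withDensity_apply _ MeasurableSet.univ] at h1
    simpa using h1
  have hlp : Measurable fun x : EuclideanSpace ℝ ι => WithLp.ofLp x :=
    (MeasurableEquiv.toLp 2 (ι → ℝ)).symm.measurable
  rw [htr F, ← aux_sphere volume φ hφ hone (fun x : EuclideanSpace ℝ ι => F (WithLp.ofLp x))
    (hF.comp hlp), htr]
  apply lintegral_congr
  intro w
  rw [hd, lintegral_withDensity_eq_lintegral_mul _ hdm, htr]
  swap
  · refine hF.comp ?_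
    fun_prop
  apply lintegral_congr
  intro g
  simp only [Pi.mul_apply]
  rw [hden]
  congr 2
  ext i
  simp only [EuclideanSpace.norm_eq, Real.norm_eq_abs, sq_abs]
  simp
  ring
open PPT in
theorem aux_tail_sum {n b : ℕ} (hb2 : b ≤ n) (f : Fin n → ℝ) :
    ∑ i ∈ Finset.univ.filter (fun i : Fin n => n - b ≤ (i : ℕ)), f i =
      ∑ j : Fin b, f ⟨n - b + j, by omega⟩ := by
  symm
  refine Finset.sum_bij (fun j _ => ⟨n - b + j, by omega⟩) ?_ ?_ ?_ ?_
  · intro j _; simp; omega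
  · intro j _ k _ h
    simp only [Fin.mk.injEq] at h
    ext; omega
  · intro i hi
    simp only [Finset.mem_filter, Finset.mem_univ, true_and] at hi
    exact ⟨⟨i - (n - b), by omega⟩, Finset.mem_univ _, by ext; simp; omega⟩
  · intro j _; rfl

open PPT in
instance aux_std_prob (k : ℕ) : IsProbabilityMeasure (stdGaussianPi k) := by
  unfold stdGaussianPi; infer_instance

open PPT in
theorem aux_chi {n b : ℕ} (hb2 : b ≤ n) (Q : ℝ) :
    stdGaussianPi n {g | tailNormSq b g ≤ Q} = chiSq b (Set.Iic Q) := by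
  have hm : Measurable fun g : Fin b → ℝ => ∑ i, g i ^ 2 := by fun_prop
  unfold chiSq
  rw [Measure.map_apply hm measurableSet_Iic]
  have hmap : (stdGaussianPi n).map (fun g (j : Fin b) => g ⟨n - b + j, by omega⟩) =
      stdGaussianPi b := by
    have h1 : iIndepFun (fun (i : Fin n) (ω : Fin n → ℝ) => ω i) (stdGaussianPi n) :=
      iIndepFun_pi (X := fun _ x => x) (fun i => aemeasurable_id)
    have h2 := h1.precomp (g := fun j : Fin b => (⟨n - b + j, by omega⟩ : Fin n)) (by
      intro j k h
      simp only [Fin.mk.injEq] at h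
      ext; omega)
    rw [iIndepFun_iff_map_fun_eq_pi_map (fun i =>
      (measurable_pi_apply _).aemeasurable)] at h2
    refine h2.trans ?_
    unfold stdGaussianPi
    congr 1
    funext j
    exact (measurePreserving_eval (fun _ : Fin n => gaussianReal 0 1) _).map_eq
  rw [← hmap, Measure.map_apply (by fun_prop) (hm measurableSet_Iic)]
  congr 1
  ext g
  simp only [Set.mem_ofPred_eq, Set.mem_preimage, Set.mem_Iic, tailNormSq]
  rw [aux_tail_sum hb2]

open PPT in
theorem aux_quantile (b : ℕ) (α0 : ℝ) (hα0 : α0 ∈ Set.Ioo (0 : ℝ) 1) :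
    0 ≤ chiSqQuantile b (1 - α0) ∧
      ENNReal.ofReal (1 - α0) ≤ chiSq b (Set.Iic (chiSqQuantile b (1 - α0))) := by
  have hm : Measurable fun g : Fin b → ℝ => ∑ i, g i ^ 2 := by fun_prop
  have : IsProbabilityMeasure (chiSq b) := Measure.isProbabilityMeasure_map hm.aemeasurable
  set S := {x : ℝ | ENNReal.ofReal (1 - α0) ≤ chiSq b (Set.Iic x)} with hS
  have hpos : ∀ x ∈ S, 0 ≤ x := by
    intro x hx
    by_contra hneg
    push Not at hneg
    have h0 : chiSq b (Set.Iic x) = 0 := by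
      unfold chiSq
      rw [Measure.map_apply hm measurableSet_Iic]
      convert measure_empty (μ := stdGaussianPi b)
      ext g
      simp only [Set.mem_preimage, Set.mem_Iic, Set.mem_empty_iff_false, iff_false, not_le]
      exact hneg.trans_le (Finset.sum_nonneg fun i _ => sq_nonneg _)
    rw [hS, Set.mem_ofPred_eq, h0] at hx
    simp at hx
    linarith [hα0.2]
  have hcdf : ∀ x, x ∈ S ↔ 1 - α0 ≤ cdf (chiSq b) x := by
    intro x
    rw [hS, Set.mem_ofPred_eq, ← ofReal_cdf, ENNReal.ofReal_le_ofReal_iff (cdf_nonneg _ _)]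
  have hne : S.Nonempty := by
    have := (tendsto_cdf_atTop (chiSq b)).eventually (eventually_ge_nhds
      (show 1 - α0 < 1 by linarith [hα0.1]))
    obtain ⟨x, hx⟩ := this.exists
    exact ⟨x, (hcdf x).2 hx⟩
  have hbdd : BddBelow S := ⟨0, hpos⟩
  refine ⟨le_csInf hne hpos, ?_⟩
  change sInf S ∈ S
  rw [hcdf]
  have hright := (cdf (chiSq b)).right_continuous (sInf S)
  have hw : Tendsto (cdf (chiSq b)) (nhdsWithin (sInf S) (Set.Ioi (sInf S)))
      (nhds (cdf (chiSq b) (sInf S))) := hright.tendsto.mono_left (nhdsWithin_mono _ Set.Ioi_subset_Ici_self)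
  refine ge_of_tendsto hw ?_
  filter_upwards [self_mem_nhdsWithin] with x hx
  obtain ⟨y, hy, hyx⟩ := exists_lt_of_csInf_lt hne hx
  exact ((hcdf y).1 hy).trans (monotone_cdf _ hyx.le)

open PPT in
theorem aux_bound {n b : ℕ} (v : Fin n → NNReal) (lo hi : ℝ) (hlo : 0 < lo)
    (hv : ∀ i : Fin n, n - b ≤ (i : ℕ) → lo ≤ v i ∧ (v i : ℝ) ≤ hi) (w : Fin n → ℝ) :
    ∃ m, 0 ≤ m ∧ ∀ w' : Fin n → ℝ, (∀ i : Fin n, (i : ℕ) < n - b → w' i = w i) →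
      tailNormSq b w' = tailNormSq b w →
      m ≤ ∏ i, gaussianPDFReal 0 (v i) (w' i) ∧
      ∏ i, gaussianPDFReal 0 (v i) (w' i) ≤
        Real.exp (tailNormSq b w / (2 * lo) - tailNormSq b w / (2 * hi)) * m := by
  set C := ∏ i, (Real.sqrt (2 * Real.pi * (v i : ℝ)))⁻¹ with hC
  have hC0 : 0 ≤ C := Finset.prod_nonneg fun i _ => by positivity
  set Hd := ∑ i ∈ Finset.univ.filter (fun i : Fin n => ¬ (n - b ≤ (i : ℕ))), w i ^ 2 / (2 * (v i : ℝ))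
    with hHd
  refine ⟨C * Real.exp (-(Hd + tailNormSq b w / (2 * lo))), by positivity, ?_⟩
  intro w' hw' hτ
  have hρ : ∏ i, gaussianPDFReal 0 (v i) (w' i) =
      C * Real.exp (-(Hd + ∑ i ∈ Finset.univ.filter (fun i : Fin n => n - b ≤ (i : ℕ)),
        w' i ^ 2 / (2 * (v i : ℝ)))) := by
    simp only [gaussianPDFReal_def]
    rw [Finset.prod_mul_distrib, ← Real.exp_sum, hC]
    congr 2
    have h1 : Hd = ∑ i ∈ Finset.univ.filter (fun i : Fin n => ¬ (n - b ≤ (i : ℕ))),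
        w' i ^ 2 / (2 * (v i : ℝ)) := by
      refine Finset.sum_congr rfl fun i hi => ?_
      simp only [Finset.mem_filter, Finset.mem_univ, true_and, not_le] at hi
      rw [hw' i hi]
    rw [h1, add_comm, Finset.sum_filter_add_sum_filter_not, ← Finset.sum_neg_distrib]
    refine Finset.sum_congr rfl fun i _ => ?_
    rw [sub_zero, neg_div]
  have hup : ∑ i ∈ Finset.univ.filter (fun i : Fin n => n - b ≤ (i : ℕ)),
        w' i ^ 2 / (2 * (v i : ℝ)) ≤ tailNormSq b w / (2 * lo) := by
    rw [← hτ, tailNormSq, Finset.sum_div]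
    refine Finset.sum_le_sum fun i hi => ?_
    simp only [Finset.mem_filter, Finset.mem_univ, true_and] at hi
    have := (hv i hi).1
    gcongr
  have hdn : tailNormSq b w / (2 * hi) ≤ ∑ i ∈ Finset.univ.filter (fun i : Fin n => n - b ≤ (i : ℕ)),
        w' i ^ 2 / (2 * (v i : ℝ)) := by
    rw [← hτ, tailNormSq, Finset.sum_div]
    refine Finset.sum_le_sum fun i hi => ?_
    simp only [Finset.mem_filter, Finset.mem_univ, true_and] at hi
    have h1 := (hv i hi).1
    have h2 := (hv i hi).2
    have h3 : (0 : ℝ) < v i := hlo.trans_le h1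
    gcongr
  rw [hρ]
  constructor
  · gcongr
  · rw [mul_left_comm, ← Real.exp_add]
    refine mul_le_mul_of_nonneg_left (Real.exp_le_exp.2 ?_) hC0
    linarith

open PPT in
theorem aux_orth {n : ℕ} (Γ : Fin n → Fin n → ℝ) (h : IsOrthogonalF Γ) (w : Fin n → ℝ) :
    tmulVecF Γ (mulVecF Γ w) = w := by
  have h1 : (Matrix.of Γ) * (Matrix.of Γ).transpose = 1 := by
    ext i j
    rw [Matrix.mul_apply, Matrix.one_apply]
    exact h i j
  have h2 : (Matrix.of Γ).transpose * (Matrix.of Γ) = 1 := mul_eq_one_comm.1 h1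
  have h3 : tmulVecF Γ (mulVecF Γ w) =
      (Matrix.of Γ).transpose.mulVec ((Matrix.of Γ).mulVec w) := by
    ext i; rfl
  rw [h3, Matrix.mulVec_mulVec, h2, Matrix.one_mulVec]

open PPT in
theorem aux_mulVec_meas {n : ℕ} (Γ : Fin n → Fin n → ℝ) : Measurable (mulVecF Γ) := by
  unfold mulVecF; fun_prop

open PPT in
theorem aux_tmulVec_meas {n : ℕ} (Γ : Fin n → Fin n → ℝ) : Measurable (tmulVecF Γ) := by
  unfold tmulVecF; fun_prop

open PPT in
theorem aux_tn_nonneg {n : ℕ} (b : ℕ) (w : Fin n → ℝ) : 0 ≤ tailNormSq b w :=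
  Finset.sum_nonneg fun _ _ => sq_nonneg _

open PPT in
theorem aux_tn_wStar {n b : ℕ} (w g : Fin n → ℝ) (hg : tailNormSq b g ≠ 0) :
    tailNormSq b (wStar b w g) = tailNormSq b w := by
  have h : ∀ i ∈ Finset.univ.filter (fun i : Fin n => n - b ≤ (i : ℕ)),
      wStar b w g i ^ 2 = tailNormSq b w / tailNormSq b g * g i ^ 2 := by
    intro i hi
    simp only [Finset.mem_filter, Finset.mem_univ, true_and] at hi
    simp only [wStar, if_neg (not_lt.2 hi)]
    rw [div_pow, mul_pow, Real.sq_sqrt (aux_tn_nonneg _ _), Real.sq_sqrt (aux_tn_nonneg _ _)]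
    ring
  conv_lhs => rw [tailNormSq]
  rw [Finset.sum_congr rfl h, ← Finset.mul_sum]
  exact div_mul_cancel₀ _ hg

open PPT in
theorem aux_wStar_wStar {n b : ℕ} (w g g' : Fin n → ℝ) (hg : tailNormSq b g ≠ 0) :
    wStar b (wStar b w g) g' = wStar b w g' := by
  funext i
  unfold wStar
  split_ifs with h
  · rfl
  · have := aux_tn_wStar w g hg
    unfold wStar at this
    rw [this]

open PPT in
theorem aux_tn_ae {n b : ℕ} (hb1 : 1 ≤ b) (hb2 : b ≤ n) :
    ∀ᵐ g ∂(stdGaussianPi n), tailNormSq b g ≠ 0 := by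
  have h0 : (stdGaussianPi n) {g | g ⟨n - 1, by omega⟩ = 0} = 0 := by
    have : NullSingletonClass (gaussianReal 0 1) := nullSingletonClass_gaussianReal one_ne_zero
    exact Measure.pi_hyperplane (fun _ : Fin n => gaussianReal 0 1) _ 0
  rw [ae_iff]
  refine measure_mono_null ?_ h0
  intro g hg
  simp only [Set.mem_ofPred_eq, not_not, tailNormSq] at hg ⊢
  rw [Finset.sum_eq_zero_iff_of_nonneg (fun i _ => sq_nonneg _)] at hg
  have := hg ⟨n - 1, by omega⟩ (by simp; omega)
  simpa using this

open PPT in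
theorem aux_wStar_meas {n b : ℕ} :
    Measurable (Function.uncurry (wStar (n := n) b)) := by
  refine measurable_pi_lambda _ fun i => ?_
  unfold Function.uncurry wStar tailNormSq
  split_ifs <;> fun_prop

open PPT in
theorem aux_wStar_inv {n b : ℕ} (hb1 : 1 ≤ b) (hb2 : b ≤ n) (F : (Fin n → ℝ) → ENNReal)
    (hF : Measurable F) :
    ∫⁻ w, ∫⁻ g, F (wStar b w g) ∂(stdGaussianPi n) = ∫⁻ w, F w := by
  let p : Fin n → Prop := fun i => (i : ℕ) < n - b
  let e := MeasurableEquiv.piEquivPiSubtypeProd (fun _ : Fin n => ℝ) p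
  have hvol : MeasurePreserving e volume volume :=
    volume_preserving_piEquivPiSubtypeProd (fun _ : Fin n => ℝ) p
  have hgau := measurePreserving_piEquivPiSubtypeProd (fun _ : Fin n => gaussianReal 0 1) p
  have : Nonempty {i // ¬ p i} := ⟨⟨⟨n - 1, by omega⟩, by simp only [p]; omega⟩⟩
  have htn : ∀ w : Fin n → ℝ, tailNormSq b w = ∑ j : {i // ¬ p i}, w j ^ 2 := by
    intro w
    unfold tailNormSq
    rw [Finset.sum_subtype (p := fun i => ¬ p i)]
    intro x; simp [p]
  let G : ({i // p i} → ℝ) × ({i // ¬ p i} → ℝ) → ENNReal := fun q => F (e.symm q)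
  have hG : Measurable G := hF.comp e.symm.measurable
  have hstep : ∀ w, ∫⁻ g, F (wStar b w g) ∂(stdGaussianPi n) =
      ∫⁻ u, G ((e w).1, fun i => Real.sqrt (∑ j, (e w).2 j ^ 2) * u i / Real.sqrt (∑ j, u j ^ 2))
        ∂(Measure.pi fun _ : {i // ¬ p i} => gaussianReal 0 1) := by
    intro w
    have h1 : ∀ g, F (wStar b w g) = (fun q : ({i // p i} → ℝ) × ({i // ¬ p i} → ℝ) =>
        G ((e w).1, fun i => Real.sqrt (∑ j, (e w).2 j ^ 2) * q.2 i / Real.sqrt (∑ j, q.2 j ^ 2)))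
        (e g) := by
      intro g
      simp only [G]
      congr 1
      rw [MeasurableEquiv.eq_symm_apply]
      refine Prod.ext ?_ ?_
      · funext i
        change wStar b w g i = w i
        simp only [wStar]
        rw [if_pos i.2]
      · funext i
        change wStar b w g i = Real.sqrt (∑ j : {i // ¬ p i}, w j ^ 2) * g i /
          Real.sqrt (∑ j : {i // ¬ p i}, g j ^ 2)
        simp only [wStar]
        rw [if_neg i.2, htn, htn]
    simp_rw [h1]
    have hme : Measurable (fun q : ({i // p i} → ℝ) × ({i // ¬ p i} → ℝ) =>
        G ((e w).1, fun i => Real.sqrt (∑ j, (e w).2 j ^ 2) * q.2 i /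
          Real.sqrt (∑ j, q.2 j ^ 2))) := by
      refine hG.comp ?_
      fun_prop
    unfold stdGaussianPi
    rw [hgau.lintegral_comp hme, lintegral_prod _ hme.aemeasurable]
    simp
  simp_rw [hstep]
  have hme2 : Measurable (fun q : (({i // p i} → ℝ) × ({i // ¬ p i} → ℝ)) × ({i // ¬ p i} → ℝ) =>
      G (q.1.1, fun i => Real.sqrt (∑ j, q.1.2 j ^ 2) * q.2 i / Real.sqrt (∑ j, q.2 j ^ 2))) := by
    refine hG.comp ?_
    fun_prop
  have hme3 : Measurable fun q : ({i // p i} → ℝ) × ({i // ¬ p i} → ℝ) =>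
      ∫⁻ u, G (q.1, fun i => Real.sqrt (∑ j, q.2 j ^ 2) * u i / Real.sqrt (∑ j, u j ^ 2))
        ∂(Measure.pi fun _ : {i // ¬ p i} => gaussianReal 0 1) := hme2.lintegral_prod_right'
  rw [hvol.lintegral_comp hme3, Measure.volume_eq_prod, lintegral_prod _ hme3.aemeasurable]
  have h4 : ∀ x : {i // p i} → ℝ, ∫⁻ y : {i // ¬ p i} → ℝ,
      ∫⁻ u, G (x, fun i => Real.sqrt (∑ j, y j ^ 2) * u i / Real.sqrt (∑ j, u j ^ 2))
        ∂(Measure.pi fun _ : {i // ¬ p i} => gaussianReal 0 1) = ∫⁻ y, G (x, y) := fun x =>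
    aux_tail (fun y => G (x, y)) (hG.comp measurable_prodMk_left)
  simp_rw [h4]
  rw [← lintegral_prod _ hG.aemeasurable, ← Measure.volume_eq_prod, ← hvol.lintegral_comp hG]
  simp [G]
theorem aux_uncurry_comp {A B C D : Type*} [MeasurableSpace A] [MeasurableSpace B]
    [MeasurableSpace C] [MeasurableSpace D] {F : A → B → C} (hF : Measurable (Function.uncurry F))
    {f : D → A} {g : D → B} (hf : Measurable f) (hg : Measurable g) :
    Measurable fun q => F (f q) (g q) :=
  hF.comp (hf.prodMk hg)

open PPT in
theorem aux_pDisc_meas {n d H : ℕ} (X : Fin n → Fin d → ℝ) (Z : Fin n → Fin H)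
    (T : (Fin n → Fin d → ℝ) → (Fin n → ℝ) → (Fin n → Fin H) → ℝ)
    (hT : Measurable fun y => T X y Z) (Γ : Fin n → Fin n → ℝ) (b : ℕ) :
    Measurable (pDisc X Z T Γ b) := by
  unfold pDisc
  refine Measurable.const_mul (Finset.measurable_sum _ fun ψ _ => ?_) _
  refine Measurable.ite (measurableSet_le hT (hT.comp ((aux_mulVec_meas Γ).comp ?_)))
    measurable_const measurable_const
  have h := aux_tmulVec_meas Γ
  exact measurable_pi_lambda _ fun i => (measurable_pi_apply (ψ i)).comp h

open PPT in
theorem aux_pCont_meas {n d H : ℕ} (X : Fin n → Fin d → ℝ) (Z : Fin n → Fin H)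
    (T : (Fin n → Fin d → ℝ) → (Fin n → ℝ) → (Fin n → Fin H) → ℝ)
    (hT : Measurable fun y => T X y Z) (Γ : Fin n → Fin n → ℝ) (b : ℕ) :
    Measurable (pCont X Z T Γ b) := by
  unfold pCont
  refine Measurable.ennreal_toReal ?_
  have hs : MeasurableSet {q : (Fin n → ℝ) × (Fin n → ℝ) |
      T X q.1 Z ≤ T X (mulVecF Γ (wStar b (tmulVecF Γ q.1) q.2)) Z} := by
    have h1 : Measurable fun q : (Fin n → ℝ) × (Fin n → ℝ) =>
        wStar b (tmulVecF Γ q.1) q.2 :=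
      aux_uncurry_comp (F := wStar (n := n) b) aux_wStar_meas
        (f := fun q : (Fin n → ℝ) × (Fin n → ℝ) => tmulVecF Γ q.1)
        (g := fun q : (Fin n → ℝ) × (Fin n → ℝ) => q.2)
        (Measurable.comp (g := tmulVecF Γ) (aux_tmulVec_meas Γ) measurable_fst) measurable_snd
    have h2 : Measurable fun q : (Fin n → ℝ) × (Fin n → ℝ) =>
        mulVecF Γ (wStar b (tmulVecF Γ q.1) q.2) :=
      Measurable.comp (g := mulVecF Γ) (aux_mulVec_meas Γ) h1
    have h3 : Measurable fun q : (Fin n → ℝ) × (Fin n → ℝ) =>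
        T X (mulVecF Γ (wStar b (tmulVecF Γ q.1) q.2)) Z :=
      Measurable.comp (g := fun y => T X y Z) hT h2
    have h4 : Measurable fun q : (Fin n → ℝ) × (Fin n → ℝ) => T X q.1 Z :=
      Measurable.comp (g := fun y => T X y Z) hT measurable_fst
    exact measurableSet_le h4 h3
  exact measurable_measure_prodMk_left hs

open PPT in
theorem aux_valid {n : ℕ} {S : Type*} [MeasurableSpace S] (ν : Measure S) [IsProbabilityMeasure ν]
    (b : ℕ) (hb1 : 1 ≤ b) (hb2 : b ≤ n)
    (Φ : (Fin n → ℝ) → S → (Fin n → ℝ)) (hΦ : Measurable (Function.uncurry Φ))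
    (hinv : ∀ F : (Fin n → ℝ) → ENNReal, Measurable F →
      ∫⁻ w, ∫⁻ s, F (Φ w s) ∂ν = ∫⁻ w, F w)
    (horb : ∀ w, ∀ᵐ s ∂ν, (∀ i : Fin n, (i : ℕ) < n - b → Φ w s i = w i) ∧
      tailNormSq b (Φ w s) = tailNormSq b w)
    (Γ : Fin n → Fin n → ℝ) (T : (Fin n → ℝ) → ℝ) (hT : Measurable T)
    (p : (Fin n → ℝ) → ℝ) (hpm : Measurable p)
    (hp0 : ∀ y, 0 ≤ p y)
    (hp : ∀ w, ∀ᵐ s ∂ν, p (mulVecF Γ (Φ w s)) =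
      (ν {s' | T (mulVecF Γ (Φ w s)) ≤ T (mulVecF Γ (Φ w s'))}).toReal)
    (a σ : ℝ) (ha : 0 ≤ a) (hσ : 0 < σ) (c : Fin n → ℝ) (hc0 : ∀ i, 0 ≤ c i)
    (hc : ∀ i j : Fin n, i ≤ j → c j ≤ c i)
    (α0 : ℝ) (hα0 : α0 ∈ Set.Ioo (0 : ℝ) 1) (α : ℝ) :
    (Measure.map (fun g : Fin n → ℝ => mulVecF Γ fun i => Real.sqrt (a * c i + σ ^ 2) * g i)
      (stdGaussianPi n)) {y | p y + ((1 / 2) * Real.exp ((1 / 2) * (a / σ ^ 2 * c ⟨n - b, Nat.sub_lt_self hb1 hb2⟩)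
        * chiSqQuantile b (1 - α0)) - 1 / 2) + α0 ≤ α} ≤ ENNReal.ofReal α := by
  obtain ⟨hQ0, hQ⟩ := aux_quantile b α0 hα0
  set Q := chiSqQuantile b (1 - α0)
  set i0 : Fin n := ⟨n - b, Nat.sub_lt_self hb1 hb2⟩ with hi0
  set ω := a / σ ^ 2 * c i0 with hω
  have hω0 : 0 ≤ ω := mul_nonneg (by positivity) (hc0 _)
  set R := Real.exp ((1 / 2) * ω * Q) with hR
  have hR1 : 1 ≤ R := Real.one_le_exp (by positivity)
  have hpos : ∀ i, 0 < a * c i + σ ^ 2 := fun i => by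
    have := mul_nonneg ha (hc0 i); positivity
  let v : Fin n → NNReal := fun i => (a * c i + σ ^ 2).toNNReal
  have hvr : ∀ i, (v i : ℝ) = a * c i + σ ^ 2 := fun i => Real.coe_toNNReal _ (hpos i).le
  have hv0 : ∀ i, v i ≠ 0 := fun i h => by
    have := hpos i
    rw [← hvr, h] at this; simp at this
  set hi := σ ^ 2 * (1 + ω) with hhi
  have hhi_eq : hi = a * c i0 + σ ^ 2 := by rw [hhi, hω]; field_simp; ring
  have hhi0 : 0 < hi := by positivity
  have hbnd : ∀ i : Fin n, n - b ≤ (i : ℕ) → σ ^ 2 ≤ v i ∧ (v i : ℝ) ≤ hi := by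
    intro i hi'
    rw [hvr, hhi_eq]
    have h1 := hc i0 i (by rw [hi0, Fin.le_def]; exact hi')
    have h2 := mul_nonneg ha (hc0 i)
    have h3 := mul_le_mul_of_nonneg_left h1 ha
    constructor <;> linarith
  -- law of the scaled Gaussian vector
  have hsm : Measurable fun (g : Fin n → ℝ) (i : Fin n) => Real.sqrt (a * c i + σ ^ 2) * g i := by
    fun_prop
  have hlaw : Measure.map (fun (g : Fin n → ℝ) (i : Fin n) => Real.sqrt (a * c i + σ ^ 2) * g i)
      (stdGaussianPi n) = (volume : Measure (Fin n → ℝ)).withDensity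
        (fun w => ENNReal.ofReal (∏ i, gaussianPDFReal 0 (v i) (w i))) := by
    rw [← aux_pi_density v hv0]
    unfold stdGaussianPi
    have hone : ∀ i, (gaussianReal 0 1).map (fun x => Real.sqrt (a * c i + σ ^ 2) * x) =
        gaussianReal 0 (v i) := by
      intro i
      rw [gaussianReal_map_const_mul]
      congr 1
      · simp
      · ext
        rw [hvr]
        simp [Real.sq_sqrt (hpos i).le]
    have : ∀ i : Fin n, SigmaFinite ((gaussianReal 0 1).map
        (fun x => Real.sqrt (a * c i + σ ^ 2) * x)) := fun i => by
      rw [hone]; infer_instance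
    rw [Measure.pi_map_pi (μ := fun _ : Fin n => gaussianReal 0 1)
      (f := fun i x => Real.sqrt (a * c i + σ ^ 2) * x) (fun i => by fun_prop)]
    congr 1
    funext i
    exact hone i
  by_cases hneg : α - (R - 1) / 2 - α0 < 0
  · have hem : {y | p y + (1 / 2 * R - 1 / 2) + α0 ≤ α} = ∅ := by
      ext y
      simp only [Set.mem_ofPred_eq, Set.mem_empty_iff_false, iff_false, not_le]
      have := hp0 y
      linarith
    rw [hem]; simp
  push Not at hneg
  set t := α - (R - 1) / 2 - α0 with ht
  have hset : {y | p y + (1 / 2 * R - 1 / 2) + α0 ≤ α} = {y | p y ≤ t} := by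
    ext y
    simp only [Set.mem_ofPred_eq, ht]
    constructor <;> intro h <;> linarith
  rw [hset]
  have hcomp : Measure.map (fun g : Fin n → ℝ => mulVecF Γ fun i => Real.sqrt (a * c i + σ ^ 2) * g i)
      (stdGaussianPi n) = Measure.map (mulVecF Γ) (Measure.map
        (fun (g : Fin n → ℝ) (i : Fin n) => Real.sqrt (a * c i + σ ^ 2) * g i) (stdGaussianPi n)) := by
    rw [Measure.map_map (aux_mulVec_meas Γ) hsm]; rfl
  rw [hcomp, Measure.map_apply (aux_mulVec_meas Γ) (measurableSet_le hpm measurable_const)]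
  have htnm : Measurable fun w : Fin n → ℝ => tailNormSq b w := by
    unfold tailNormSq; fun_prop
  have hE : MeasurableSet {w : Fin n → ℝ | tailNormSq b w ≤ hi * Q} :=
    measurableSet_le htnm measurable_const
  have hEc : (Measure.map (fun (g : Fin n → ℝ) (i : Fin n) => Real.sqrt (a * c i + σ ^ 2) * g i)
      (stdGaussianPi n)) {w : Fin n → ℝ | tailNormSq b w ≤ hi * Q}ᶜ ≤ ENNReal.ofReal α0 := by
    rw [Measure.map_apply hsm hE.compl]
    have hG : MeasurableSet {g : Fin n → ℝ | tailNormSq b g ≤ Q} :=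
      measurableSet_le htnm measurable_const
    calc _ ≤ stdGaussianPi n {g | tailNormSq b g ≤ Q}ᶜ := by
          apply measure_mono
          intro g hg hgQ
          apply hg
          simp only [Set.mem_ofPred_eq] at hgQ ⊢
          calc _ ≤ hi * tailNormSq b g := by
                unfold tailNormSq
                rw [Finset.mul_sum]
                refine Finset.sum_le_sum fun i hi' => ?_
                simp only [Finset.mem_filter, Finset.mem_univ, true_and] at hi'
                rw [mul_pow, Real.sq_sqrt (hpos i).le, ← hvr]
                exact mul_le_mul_of_nonneg_right (hbnd i hi').2 (sq_nonneg _)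
            _ ≤ _ := mul_le_mul_of_nonneg_left hgQ hhi0.le
      _ = 1 - chiSq b (Set.Iic Q) := by rw [prob_compl_eq_one_sub hG, aux_chi hb2]
      _ ≤ 1 - ENNReal.ofReal (1 - α0) := tsub_le_tsub_left hQ _
      _ = ENNReal.ofReal α0 := by
          rw [← ENNReal.ofReal_one, ← ENNReal.ofReal_sub _ (by linarith [hα0.2])]
          congr 1; ring
  have hprob : IsProbabilityMeasure (Measure.map
      (fun (g : Fin n → ℝ) (i : Fin n) => Real.sqrt (a * c i + σ ^ 2) * g i)
      (stdGaussianPi n)) := Measure.isProbabilityMeasure_map hsm.aemeasurable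
  rw [hlaw] at hEc hprob ⊢
  have hρm : Measurable fun w : Fin n → ℝ => ∏ i, gaussianPDFReal 0 (v i) (w i) := by
    refine Finset.measurable_prod _ fun i _ => ?_
    exact (measurable_gaussianPDFReal 0 (v i)).comp (measurable_pi_apply i)
  have hmain := aux_main volume ν Φ hΦ _ hρm hprob hinv (fun w => T (mulVecF Γ w))
    (hT.comp (aux_mulVec_meas Γ)) (fun w => p (mulVecF Γ w)) (hpm.comp (aux_mulVec_meas Γ)) hp
    _ hE (fun w => by
      filter_upwards [horb w] with s hs
      simp only [hs.2]) R hR1 (fun w hw => by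
      obtain ⟨m, hm0, hm⟩ := aux_bound v (σ ^ 2) hi (by positivity) hbnd w
      refine ⟨m, hm0, ?_⟩
      filter_upwards [horb w] with s hs
      obtain ⟨h1, h2⟩ := hm _ hs.1 hs.2
      refine ⟨h1, h2.trans (mul_le_mul_of_nonneg_right (Real.exp_le_exp.2 ?_) hm0)⟩
      simp only [Set.mem_ofPred_eq] at hw
      have e1 : tailNormSq b w / (2 * σ ^ 2) - tailNormSq b w / (2 * hi) =
          tailNormSq b w * (ω / (2 * hi)) := by
        rw [hhi]
        have : 1 + ω ≠ 0 := by positivity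
        field_simp
        ring
      rw [e1]
      calc _ ≤ hi * Q * (ω / (2 * hi)) := mul_le_mul_of_nonneg_right hw (by positivity)
        _ = 1 / 2 * ω * Q := by field_simp) α0 hα0.1.le hEc t hneg
  refine hmain.trans (le_of_eq ?_)
  congr 1
  rw [ht]; ring

open PPT in
theorem aux_perm_mem {n b : ℕ} (ψ0 ψ : Equiv.Perm (Fin n)) (h0 : ψ0 ∈ permSet n b) :
    ψ ∈ permSet n b ↔ ψ0 * ψ ∈ permSet n b := by
  simp only [permSet, Finset.mem_filter, Finset.mem_univ, true_and] at *
  refine forall_congr' fun i => ?_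
  refine imp_congr_right fun hi => ?_
  rw [Equiv.Perm.mul_apply]
  constructor
  · intro h; rw [h, h0 i hi]
  · intro h
    apply ψ0.injective
    rw [h, h0 i hi]

open PPT in
theorem aux_perm_tail {n b : ℕ} (ψ : Equiv.Perm (Fin n)) (h0 : ψ ∈ permSet n b) (w : Fin n → ℝ) :
    tailNormSq b (w ∘ ψ) = tailNormSq b w := by
  simp only [permSet, Finset.mem_filter, Finset.mem_univ, true_and] at h0
  unfold tailNormSq
  refine Finset.sum_equiv ψ ?_ (fun i _ => rfl)
  intro i
  simp only [Finset.mem_filter, Finset.mem_univ, true_and]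
  constructor
  · intro hi
    by_contra hlt
    push Not at hlt
    have := ψ.injective (h0 _ hlt)
    rw [this] at hlt
    omega
  · intro hi
    by_contra hlt
    push Not at hlt
    rw [h0 _ hlt] at hi
    omega

open PPT in
/-- Theorem 4: under the Gaussian process regression null model, where
`Y ~ N(0, (δ₀²/n^{1-γ}) Kₙ + σ₀² Iₙ)`, the corrected partial permutation p-value
`p̃_c = p + ṽ(b, ξₙ, α₀) + α₀` is valid.  Here the law of `Y` is realized through the
eigendecomposition `Kₙ = Γ diag(c) Γᵀ`: `Y = Γ (√(δ₀²c_i/n^{1-γ} + σ₀²) g_i)_i` for a standard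
Gaussian vector `g`, which has exactly the stated covariance. -/
theorem partial_permutation_valid_GPR_corrected
    {n d H : ℕ} (hn : 1 ≤ n)
    (X : Fin n → Fin d → ℝ) (Z : Fin n → Fin H)
    -- variance parameters of the GPR model
    (δ0 σ0 : ℝ) (hδ0 : 0 < δ0) (hσ0 : 0 < σ0) (γ : ℝ)
    -- a symmetric positive semidefinite kernel and its sample kernel matrix
    (K : (Fin d → ℝ) → (Fin d → ℝ) → ℝ) (hK : IsPSDKernel K)
    (Kn : Fin n → Fin n → ℝ) (hKn : ∀ i j, Kn i j = K (X i) (X j))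
    -- a fixed eigendecomposition Kn = Γ diag(c) Γᵀ
    (Γ : Fin n → Fin n → ℝ) (c : Fin n → ℝ) (hEig : IsEigenDecomp Kn Γ c)
    -- the law of Y : multivariate Gaussian, mean 0, covariance (δ₀²/n^{1-γ}) Kₙ + σ₀² Iₙ
    (μY : Measure (Fin n → ℝ))
    (hμY : μY = Measure.map
      (fun g : Fin n → ℝ =>
        mulVecF Γ fun i =>
          Real.sqrt (δ0 ^ 2 / (n : ℝ) ^ ((1 : ℝ) - γ) * c i + σ0 ^ 2) * g i)
      (stdGaussianPi n))
    -- permutation size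
    (b : ℕ) (hb1 : 1 ≤ b) (hb2 : b ≤ n)
    -- arbitrary (measurable) test statistic
    (T : (Fin n → Fin d → ℝ) → (Fin n → ℝ) → (Fin n → Fin H) → ℝ)
    (hT : Measurable fun y => T X y Z)
    -- correction level α₀
    (α0 : ℝ) (hα0 : α0 ∈ Set.Ioo (0 : ℝ) 1)
    -- ξₙ = (δ₀²/n^{1-γ})/σ₀², ω̃(b, ξₙ) = ξₙ · c_{n-b+1}, and the correction term ṽ(b, ξₙ, α₀)
    (ξ ωt vt : ℝ)
    (hξ : ξ = (δ0 ^ 2 / (n : ℝ) ^ ((1 : ℝ) - γ)) / σ0 ^ 2)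
    (hωt : ωt = ξ * c ⟨n - b, by omega⟩)
    (hvt : vt = (1 / 2) * Real.exp ((1 / 2) * ωt * chiSqQuantile b (1 - α0)) - 1 / 2) :
    ∀ α ∈ Set.Ioo (0 : ℝ) 1,
      μY {y | pDisc X Z T Γ b y + vt + α0 ≤ α} ≤ ENNReal.ofReal α ∧
      μY {y | pCont X Z T Γ b y + vt + α0 ≤ α} ≤ ENNReal.ofReal α := by
  have ha : 0 ≤ δ0 ^ 2 / (n : ℝ) ^ ((1 : ℝ) - γ) := by positivity
  obtain ⟨hO, -, hc, hc0⟩ := hEig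
  intro α _
  subst hμY hvt hωt hξ
  constructor
  · let S := {ψ : Equiv.Perm (Fin n) // ψ ∈ permSet n b}
    let : MeasurableSpace S := ⊤
    have : DiscreteMeasurableSpace S := ⟨fun _ => trivial⟩
    have : Nonempty S := ⟨⟨1, by simp [permSet]⟩⟩
    let ν : Measure S := (Fintype.card S : ENNReal)⁻¹ • Measure.count
    have hcard0 : (Fintype.card S : ENNReal) ≠ 0 := by simp
    have hcardT : (Fintype.card S : ENNReal) ≠ ⊤ := ENNReal.natCast_ne_top _
    have hcardS : Fintype.card S = (permSet n b).card := Fintype.card_coe _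
    have : IsProbabilityMeasure ν := ⟨by
      simp only [ν, Measure.smul_apply, smul_eq_mul]
      rw [Measure.count_univ]
      simp only [ENat.card_eq_coe_fintype_card, ENat.toENNReal_coe]
      exact ENNReal.inv_mul_cancel hcard0 hcardT⟩
    refine aux_valid ν b hb1 hb2 (fun w ψ => w ∘ ψ.1) ?_ ?_ ?_ Γ (fun y => T X y Z) hT
      (pDisc X Z T Γ b) (aux_pDisc_meas X Z T hT Γ b) ?_ ?_ _ σ0 ha hσ0 c hc0 hc α0 hα0 α
    · refine measurable_from_prod_countable_left fun ψ => ?_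
      exact measurable_pi_lambda _ fun i => measurable_pi_apply (ψ.1 i)
    · intro F hF
      have h1 : ∀ ψ : S, ∫⁻ w : Fin n → ℝ, F (w ∘ ψ.1) = ∫⁻ w, F w := by
        intro ψ
        have := volume_measurePreserving_piCongrLeft (fun _ : Fin n => ℝ) (ψ.1)⁻¹
        rw [← this.lintegral_comp hF]
        apply lintegral_congr
        intro w
        congr 1
        funext i
        have h3 := Equiv.piCongrLeft_apply_apply (fun _ : Fin n => ℝ) (ψ.1)⁻¹ w (ψ.1 i)
        have h4 : (ψ.1)⁻¹ (ψ.1 i) = i := Equiv.symm_apply_apply ψ.1 i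
        rw [h4] at h3
        exact h3.symm
      have h2 : ∀ w : Fin n → ℝ, ∫⁻ ψ : S, F (w ∘ ψ.1) ∂ν =
          (Fintype.card S : ENNReal)⁻¹ * ∑ ψ : S, F (w ∘ ψ.1) := by
        intro w
        simp only [ν]
        rw [lintegral_smul_measure, lintegral_count, tsum_fintype, smul_eq_mul]
      have hmeas : ∀ ψ : S, Measurable fun w : Fin n → ℝ => F (w ∘ ψ.1) := fun ψ =>
        hF.comp (measurable_pi_lambda _ fun i => measurable_pi_apply _)
      simp_rw [h2]
      rw [lintegral_const_mul _ (Finset.measurable_sum _ fun ψ _ => hmeas ψ),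
        lintegral_finsetSum _ (fun ψ _ => hmeas ψ)]
      simp_rw [h1]
      rw [Finset.sum_const, Finset.card_univ, nsmul_eq_mul, ← mul_assoc,
        ENNReal.inv_mul_cancel hcard0 hcardT, one_mul]
    · intro w
      refine ae_of_all _ fun ψ => ⟨fun i hi => ?_, aux_perm_tail ψ.1 ψ.2 w⟩
      have := ψ.2
      simp only [permSet, Finset.mem_filter, Finset.mem_univ, true_and] at this
      simp only [Function.comp, this i hi]
    · intro y
      unfold pDisc
      refine mul_nonneg (by positivity) (Finset.sum_nonneg fun ψ _ => ?_)
      split_ifs <;> norm_num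
    · intro w
      refine ae_of_all _ fun ψ0 => ?_
      classical
      simp only [ν, Measure.smul_apply, smul_eq_mul]
      rw [Measure.count_apply_finite _ (Set.toFinite _), ENNReal.toReal_mul]
      simp only [pDisc, aux_orth Γ hO, ENNReal.toReal_inv, ENNReal.toReal_natCast, hcardS]
      congr 1
      have e1 : ∑ ψ ∈ permSet n b, (if T X (mulVecF Γ (w ∘ ψ0.1)) Z ≤
            T X (mulVecF Γ ((w ∘ ψ0.1) ∘ ψ)) Z then (1 : ℝ) else 0) =
          ∑ ψ ∈ permSet n b, (if T X (mulVecF Γ (w ∘ ψ0.1)) Z ≤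
            T X (mulVecF Γ (w ∘ ψ)) Z then (1 : ℝ) else 0) := by
        refine Finset.sum_equiv (Equiv.mulLeft ψ0.1) (fun ψ => aux_perm_mem ψ0.1 ψ ψ0.2) ?_
        intro ψ _
        rfl
      rw [e1, ← Finset.sum_coe_sort (permSet n b), Finset.sum_boole]
      congr 2
      ext ψ
      simp
  · refine aux_valid (stdGaussianPi n) b hb1 hb2 (wStar b) aux_wStar_meas
      (fun F hF => aux_wStar_inv hb1 hb2 F hF) ?_ Γ (fun y => T X y Z) hT
      (pCont X Z T Γ b) (aux_pCont_meas X Z T hT Γ b) ?_ ?_ _ σ0 ha hσ0 c hc0 hc α0 hα0 α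
    · intro w
      filter_upwards [aux_tn_ae hb1 hb2] with g hg
      refine ⟨fun i hi => ?_, aux_tn_wStar w g hg⟩
      simp only [wStar, if_pos hi]
    · intro y
      exact ENNReal.toReal_nonneg
    · intro w
      filter_upwards [aux_tn_ae hb1 hb2] with g hg
      unfold pCont
      simp only [aux_orth Γ hO, aux_wStar_wStar w g _ hg]
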